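/- If I = (i_1,…,i_n) and I' = (i'_1,…,i'_n) in ℕ_0^n satisfy i_ℓ ≤ i'_ℓ for all ℓ = 1,…,n, then for every N ≥ d‖I‖ one has L_N^I ⊂ L_{N−d‖I‖+d‖I'‖}^{I'}, and consequently L^I ⊂ L^{I'}. -/

import Mathlib

open Filter MvPolynomial

namespace MovingTargets

noncomputable section

variable {k Λ : Type} [Field k]

/-- The filter of cofinite subsets of `A` (as a filter on `Λ`). -/
def cofinOn (Λ : Type) (A : Set Λ) : Filter Λ := Filter.cofinite ⊓ Filter.principal A

/-- A subset `A ⊆ Λ` is coherent with respect to the moving hypersurfaces `Q` if every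
polynomial in the coefficients of the `Q j`, homogeneous in the block of coefficients of
each `Q j`, vanishes at all `α ∈ A` or at only finitely many of them. -/
def Coherent {M q : ℕ} (A : Set Λ) (Q : Fin q → Λ → MvPolynomial (Fin (M + 1)) k) : Prop :=
  ∀ P : MvPolynomial (Fin q × (Fin (M + 1) →₀ ℕ)) k,
    (∀ j : Fin q, ∃ e : ℕ, ∀ m ∈ P.support,
        (m.sum fun v c => if v.1 = j then c else 0) = e) →
    ((∀ α ∈ A, MvPolynomial.eval (fun p => MvPolynomial.coeff p.2 (Q p.1 α)) P = 0) ∨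
      {α ∈ A | MvPolynomial.eval (fun p => MvPolynomial.coeff p.2 (Q p.1 α)) P = 0}.Finite)

/-- The normalized coefficient ratio functions `α ↦ a_{j,I}(α) / a_{j,I_j}(α)`. -/
def ratioFun {M q : ℕ} (Q : Fin q → Λ → MvPolynomial (Fin (M + 1)) k)
    (Ij : Fin q → (Fin (M + 1) →₀ ℕ)) (j : Fin q) (I : Fin (M + 1) →₀ ℕ) : Λ → k :=
  fun α => MvPolynomial.coeff I (Q j α) / MvPolynomial.coeff (Ij j) (Q j α)

/-- The subring of (pointwise) functions `Λ → k` generated over `k` by the coefficient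
ratio functions. -/
def kQRing {M q : ℕ} (Q : Fin q → Λ → MvPolynomial (Fin (M + 1)) k)
    (Ij : Fin q → (Fin (M + 1) →₀ ℕ)) : Subring (Λ → k) :=
  Subring.closure
    (Set.range (fun c : k => Function.const Λ c) ∪ {f | ∃ j I, f = ratioFun Q Ij j I})

/-- The ring `R_A^0` of maps on cofinite subsets of `A` modulo agreement on cofinite
subsets is the ring of germs along `cofinOn Λ A`; this is the canonical map to it. -/
def germHom (A : Set Λ) : (Λ → k) →+* (cofinOn Λ A).Germ k := Filter.Germ.coeRingHom _

/-- The subring of `R_A^0` generated over `k` by the coefficient ratios of the `Q j`. -/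
def SG {M q : ℕ} (A : Set Λ) (Q : Fin q → Λ → MvPolynomial (Fin (M + 1)) k)
    (Ij : Fin q → (Fin (M + 1) →₀ ℕ)) : Subring ((cofinOn Λ A).Germ k) :=
  (kQRing Q Ij).map (germHom A)

/-- The field `R_{A,Q}`: the total fraction ring of the subring of `R_A^0` generated
over `k` by the coefficient ratios (a field, i.e. the field of fractions, when `A` is
coherent, since then this subring is an integral domain). -/
def RAQ {M q : ℕ} (A : Set Λ) (Q : Fin q → Λ → MvPolynomial (Fin (M + 1)) k)
    (Ij : Fin q → (Fin (M + 1) →₀ ℕ)) : Type :=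
  FractionRing ↥(SG A Q Ij)

instance instCommRingRAQ {M q : ℕ} (A : Set Λ) (Q : Fin q → Λ → MvPolynomial (Fin (M + 1)) k)
    (Ij : Fin q → (Fin (M + 1) →₀ ℕ)) : CommRing (RAQ A Q Ij) :=
  inferInstanceAs (CommRing (FractionRing ↥(SG A Q Ij)))

instance instAlgebraRAQ {M q : ℕ} (A : Set Λ) (Q : Fin q → Λ → MvPolynomial (Fin (M + 1)) k)
    (Ij : Fin q → (Fin (M + 1) →₀ ℕ)) : Algebra ↥(SG A Q Ij) (RAQ A Q Ij) :=
  inferInstanceAs (Algebra ↥(SG A Q Ij) (FractionRing ↥(SG A Q Ij)))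

/-- The element of `R_{A,Q}` determined by a function in `kQRing`. -/
def toRAQ {M q : ℕ} (A : Set Λ) (Q : Fin q → Λ → MvPolynomial (Fin (M + 1)) k)
    (Ij : Fin q → (Fin (M + 1) →₀ ℕ)) (f : Λ → k) (hf : f ∈ kQRing Q Ij) : RAQ A Q Ij :=
  algebraMap (SG A Q Ij) (RAQ A Q Ij) ⟨germHom A f, Subring.mem_map.mpr ⟨f, hf, rfl⟩⟩

/-- The embedding of `k` into `R_{A,Q}` as constants. -/
def kToRAQ {M q : ℕ} (A : Set Λ) (Q : Fin q → Λ → MvPolynomial (Fin (M + 1)) k)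
    (Ij : Fin q → (Fin (M + 1) →₀ ℕ)) : k →+* RAQ A Q Ij :=
  (algebraMap (SG A Q Ij) (RAQ A Q Ij)).comp
    (((germHom A).comp (Pi.constRingHom Λ k)).codRestrict (SG A Q Ij) fun c =>
      Subring.mem_map.mpr ⟨_, Subring.subset_closure (Or.inl ⟨c, rfl⟩), rfl⟩)

/-- The coefficient ratio `a_{j,I}/a_{j,I_j}` as an element of `R_{A,Q}`. -/
def ratioRAQ {M q : ℕ} (A : Set Λ) (Q : Fin q → Λ → MvPolynomial (Fin (M + 1)) k)
    (Ij : Fin q → (Fin (M + 1) →₀ ℕ)) (j : Fin q) (I : Fin (M + 1) →₀ ℕ) : RAQ A Q Ij :=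
  toRAQ A Q Ij (ratioFun Q Ij j I) (Subring.subset_closure (Or.inr ⟨j, I, rfl⟩))

/-- `â : Λ → k` is a special representative of `a ∈ R_{A,Q}` if `â = b/c` pointwise for
functions `b, c` in the ring generated by the coefficient ratios, with `c(α) ≠ 0` for all
but finitely many `α ∈ A` and `a = [b]/[c]` in `R_{A,Q}`. -/
def IsSpecialRep {M q : ℕ} (A : Set Λ) (Q : Fin q → Λ → MvPolynomial (Fin (M + 1)) k)
    (Ij : Fin q → (Fin (M + 1) →₀ ℕ)) (a : RAQ A Q Ij) (ahat : Λ → k) : Prop :=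
  ∃ (b c : Λ → k) (hb : b ∈ kQRing Q Ij) (hc : c ∈ kQRing Q Ij),
    (∀ᶠ α in cofinOn Λ A, c α ≠ 0) ∧
    toRAQ A Q Ij b hb = a * toRAQ A Q Ij c hc ∧
    ahat = fun α => b α / c α

/-- A special representative of a polynomial with coefficients in `R_{A,Q}`. -/
def IsPolyRep {M q : ℕ} (A : Set Λ) (Q : Fin q → Λ → MvPolynomial (Fin (M + 1)) k)
    (Ij : Fin q → (Fin (M + 1) →₀ ℕ)) (P : MvPolynomial (Fin (M + 1)) (RAQ A Q Ij))
    (Phat : Λ → MvPolynomial (Fin (M + 1)) k) : Prop :=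
  ∀ I, IsSpecialRep A Q Ij (MvPolynomial.coeff I P) fun α => MvPolynomial.coeff I (Phat α)

/-- The evaluation `W(α)` of a subspace `W ⊆ R_{A,Q}[x_0,…,x_M]` at `α`: the `k`-subspace
spanned by all evaluations at `α` of special representatives of elements of `W`. -/
def evalSubspace {M q : ℕ} (A : Set Λ) (Q : Fin q → Λ → MvPolynomial (Fin (M + 1)) k)
    (Ij : Fin q → (Fin (M + 1) →₀ ℕ))
    (W : Submodule (RAQ A Q Ij) (MvPolynomial (Fin (M + 1)) (RAQ A Q Ij))) (α : Λ) :
    Submodule k (MvPolynomial (Fin (M + 1)) k) :=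
  Submodule.span k
    {p | ∃ P ∈ W, ∃ Phat, IsPolyRep A Q Ij P Phat ∧ p = Phat α}

/-- The ideal `I_{A,Q}(V)` of `R_{A,Q}[x_0,…,x_M]` generated by the ideal `I(V)`. -/
def IAQV {M q : ℕ} (A : Set Λ) (Q : Fin q → Λ → MvPolynomial (Fin (M + 1)) k)
    (Ij : Fin q → (Fin (M + 1) →₀ ℕ)) (IV : Ideal (MvPolynomial (Fin (M + 1)) k)) :
    Ideal (MvPolynomial (Fin (M + 1)) (RAQ A Q Ij)) :=
  Ideal.map (MvPolynomial.map (kToRAQ A Q Ij)) IV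

/-- The family `Q` is `V`-admissible: for each choice of `n+1` of the moving
hypersurfaces, for all but finitely many `α` they have no common zero on `V(k̄)`. -/
def Admissible {M q : ℕ} (IV : Ideal (MvPolynomial (Fin (M + 1)) k))
    (Q : Fin q → Λ → MvPolynomial (Fin (M + 1)) k) (n : ℕ) : Prop :=
  ∀ J : Finset (Fin q), J.card = n + 1 →
    {α : Λ | ∃ x : Fin (M + 1) → AlgebraicClosure k, x ≠ 0 ∧
      (∀ P ∈ IV, MvPolynomial.eval x
        (MvPolynomial.map (algebraMap k (AlgebraicClosure k)) P) = 0) ∧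
      (∀ j ∈ J, MvPolynomial.eval x
        (MvPolynomial.map (algebraMap k (AlgebraicClosure k)) (Q j α)) = 0)}.Finite

/-- The set `L_N^I`. -/
def LNIset {R : Type} [CommRing R] {σ : Type} {n : ℕ} (Qn : Fin n → MvPolynomial σ R)
    (J : Ideal (MvPolynomial σ R)) (d : ℕ) (I : Fin n → ℕ) (N : ℕ) :
    Set (MvPolynomial σ R) :=
  {γ | γ ∈ homogeneousSubmodule σ R (N - d * ∑ i, I i) ∧
    ∃ γE : (Fin n → ℕ) → MvPolynomial σ R,
      (∀ E, γE E ∈ homogeneousSubmodule σ R (N - d * ∑ i, E i)) ∧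
      (∀ E, γE E ≠ 0 → toLex I < toLex E ∧ d * ∑ i, E i ≤ N) ∧
      {E | γE E ≠ 0}.Finite ∧
      (∏ s, Qn s ^ I s) * γ - ∑ᶠ E, (∏ s, Qn s ^ E s) * γE E ∈ J}

/-- The homogeneous ideal `L^I` generated by `⋃_{N ≥ d‖I‖} L_N^I`. -/
def LIdeal {R : Type} [CommRing R] {σ : Type} {n : ℕ} (Qn : Fin n → MvPolynomial σ R)
    (J : Ideal (MvPolynomial σ R)) (d : ℕ) (I : Fin n → ℕ) : Ideal (MvPolynomial σ R) :=
  Ideal.span (⋃ N ∈ {N : ℕ | d * ∑ i, I i ≤ N}, LNIset Qn J d I N)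

/-- `m_N^I`, the dimension over `R_{A,Q}` of `R_{A,Q}[x_0,…,x_M]_{N-d‖I‖} / L_N^I`. -/
def mNI {R : Type} [CommRing R] {σ : Type} {n : ℕ} (Qn : Fin n → MvPolynomial σ R)
    (J : Ideal (MvPolynomial σ R)) (d : ℕ) (I : Fin n → ℕ) (N : ℕ) : ℕ :=
  Module.finrank R
    ↥(Submodule.map (Submodule.span R (LNIset Qn J d I N)).mkQ
      (homogeneousSubmodule σ R (N - d * ∑ i, I i)))

/-- The dimension of the degree-`N` part of the quotient of the polynomial ring by the
ideal `J`; for `J = I(V)` this is the Hilbert function `H_V(N)`. -/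
def hilbert {R : Type} [CommRing R] {σ : Type} (J : Ideal (MvPolynomial σ R)) (N : ℕ) :
    ℕ :=
  Module.finrank R
    ↥(Submodule.map (Submodule.restrictScalars R J).mkQ (homogeneousSubmodule σ R N))

end

end MovingTargets

namespace MovingTargets

/-- Multiplying by `∏ Q_s ^ D_s` carries the relation defining `L_N^I` to the one defining
`L_{N+d‖D‖}^{I+D}`. -/
theorem LNIset_subset_add {R : Type} [CommRing R] {σ : Type} {n : ℕ}
    (Qn : Fin n → MvPolynomial σ R) (J : Ideal (MvPolynomial σ R)) (d : ℕ)
    (I D : Fin n → ℕ) (N : ℕ) :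
    LNIset Qn J d I N ⊆ LNIset Qn J d (I + D) (N + d * ∑ i, D i) := by
  rintro γ ⟨hγ, γE, hhom, hlt, hfin, hmem⟩
  have hinj : Function.Injective (fun E : Fin n → ℕ => E + D) := add_left_injective D
  have hdeg (E : Fin n → ℕ) :
      N + d * ∑ i, D i - d * ∑ i, (E + D) i = N - d * ∑ i, E i := by
    simp only [Pi.add_apply, Finset.sum_add_distrib, mul_add, Nat.add_sub_add_right]
  let γE' : (Fin n → ℕ) → MvPolynomial σ R := Function.extend (· + D) γE 0
  have happ (E : Fin n → ℕ) : γE' (E + D) = γE E := hinj.extend_apply γE 0 E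
  have hout (E : Fin n → ℕ) (hE : E ∉ Set.range (fun E : Fin n → ℕ => E + D)) : γE' E = 0 :=
    Function.extend_apply' _ _ _ hE
  have hprod (E : Fin n → ℕ) :
      ∏ s, Qn s ^ (E + D) s = (∏ s, Qn s ^ D s) * ∏ s, Qn s ^ E s := by
    rw [← Finset.prod_mul_distrib]
    exact Finset.prod_congr rfl fun s _ => by rw [Pi.add_apply, pow_add, mul_comm]
  refine ⟨by rwa [hdeg], γE', fun E => ?_, fun E hE => ?_, ?_, ?_⟩
  · by_cases h : E ∈ Set.range (fun E : Fin n → ℕ => E + D)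
    · obtain ⟨E, rfl⟩ := h
      rw [happ, hdeg]
      exact hhom E
    · rw [hout E h]
      exact Submodule.zero_mem _
  · obtain ⟨E, rfl⟩ : E ∈ Set.range (fun E : Fin n → ℕ => E + D) := by
      by_contra h
      exact hE (hout E h)
    rw [happ] at hE
    obtain ⟨⟨i, hi, hi'⟩, hN⟩ := hlt E hE
    refine ⟨⟨i, fun j hj => congrArg (· + D j) (hi j hj), Nat.add_lt_add_right hi' (D i)⟩, ?_⟩
    simp only [Pi.add_apply, Finset.sum_add_distrib, mul_add]
    exact Nat.add_le_add_right hN _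
  · refine (hfin.image (· + D)).subset fun E hE => ?_
    obtain ⟨E, rfl⟩ : E ∈ Set.range (fun E : Fin n → ℕ => E + D) := by
      by_contra h
      exact hE (hout E h)
    exact ⟨E, by simpa only [Set.mem_ofPred_eq, happ] using hE, rfl⟩
  · have hsupp : (Function.support fun E => (∏ s, Qn s ^ E s) * γE E).Finite :=
      hfin.subset fun E hE => right_ne_zero_of_mul hE
    have hsum : ∑ᶠ E, (∏ s, Qn s ^ E s) * γE' E =
        (∏ s, Qn s ^ D s) * ∑ᶠ E, (∏ s, Qn s ^ E s) * γE E := by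
      rw [mul_finsum' _ _ hsupp]
      calc ∑ᶠ E, (∏ s, Qn s ^ E s) * γE' E
          = ∑ᶠ E ∈ Set.range (fun E : Fin n → ℕ => E + D), (∏ s, Qn s ^ E s) * γE' E := by
            rw [← finsum_mem_univ]
            refine finsum_mem_inter_support_eq' _ _ _ fun E hE => ?_
            refine iff_of_true trivial ?_
            by_contra h
            exact hE (by simp only [hout E h, mul_zero])
        _ = ∑ᶠ E, (∏ s, Qn s ^ (E + D) s) * γE' (E + D) := finsum_mem_range hinj
        _ = _ := finsum_congr fun E => by rw [happ, hprod, mul_assoc]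
    rw [hsum, hprod, mul_assoc, ← mul_sub]
    exact J.mul_mem_left _ hmem

end MovingTargets

set_option maxHeartbeats 1000000 in
open MovingTargets Filter MvPolynomial in
/-- If `I ≤ I'` componentwise, then for every `N ≥ d‖I‖` one has
`L_N^I ⊆ L_{N−d‖I‖+d‖I'‖}^{I'}`, and consequently `L^I ⊆ L^{I'}`. -/
theorem LNI_mono
    {k Λ : Type} [Field k] [NumberField k] {M q : ℕ}
    (hq : 0 < q)
    (Q : Fin q → Λ → MvPolynomial (Fin (M + 1)) k)
    (d : ℕ) (hd : 0 < d)
    (hQhom : ∀ j α, (Q j α).IsHomogeneous d)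
    (hQne : ∀ j α, Q j α ≠ 0)
    (A : Set Λ) (hA : A.Infinite) (hcoh : Coherent A Q)
    (Ij : Fin q → (Fin (M + 1) →₀ ℕ))
    (hIj : ∀ j, ∀ᶠ α in cofinOn Λ A, MvPolynomial.coeff (Ij j) (Q j α) ≠ 0)
    (QR : Fin q → MvPolynomial (Fin (M + 1)) (RAQ A Q Ij))
    (hQR : ∀ j I, MvPolynomial.coeff I (QR j) = ratioRAQ A Q Ij j I)
    {n : ℕ} (hnq : n ≤ q)
    (IV : Ideal (MvPolynomial (Fin (M + 1)) k)) (hIVprime : IV.IsPrime)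
    (hIVhom : ∃ G : Set (MvPolynomial (Fin (M + 1)) k),
      (∀ g ∈ G, ∃ m, g.IsHomogeneous m) ∧ Ideal.span G = IV)
    (hdim : ringKrullDim (MvPolynomial (Fin (M + 1)) k ⧸ IV) = (n : ℕ) + 1)
    (I I' : Fin n → ℕ) (hII' : ∀ ℓ, I ℓ ≤ I' ℓ) :
    (∀ N : ℕ, d * ∑ i, I i ≤ N →
      LNIset (fun s : Fin n => QR (Fin.castLE hnq s)) (IAQV A Q Ij IV) d I N ⊆
        LNIset (fun s : Fin n => QR (Fin.castLE hnq s)) (IAQV A Q Ij IV) d I'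
          (N - d * ∑ i, I i + d * ∑ i, I' i)) ∧
    LIdeal (fun s : Fin n => QR (Fin.castLE hnq s)) (IAQV A Q Ij IV) d I ≤
      LIdeal (fun s : Fin n => QR (Fin.castLE hnq s)) (IAQV A Q Ij IV) d I' := by
  obtain ⟨D, rfl⟩ : ∃ D, I' = I + D := ⟨I' - I, (add_tsub_cancel_of_le hII').symm⟩
  have hsub : ∀ N : ℕ, d * ∑ i, I i ≤ N →
      LNIset (fun s : Fin n => QR (Fin.castLE hnq s)) (IAQV A Q Ij IV) d I N ⊆
        LNIset (fun s : Fin n => QR (Fin.castLE hnq s)) (IAQV A Q Ij IV) d (I + D)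
          (N - d * ∑ i, I i + d * ∑ i, (I + D) i) := by
    intro N hN
    have hdeg : N - d * ∑ i, I i + d * ∑ i, (I + D) i = N + d * ∑ i, D i := by
      simp only [Pi.add_apply, Finset.sum_add_distrib, mul_add]
      omega
    rw [hdeg]
    exact LNIset_subset_add _ _ d I D N
  refine ⟨hsub, Ideal.span_mono (Set.iUnion₂_subset fun N hN => (hsub N hN).trans ?_)⟩
  exact Set.subset_biUnion_of_mem
    (u := fun N => LNIset (fun s : Fin n => QR (Fin.castLE hnq s)) (IAQV A Q Ij IV) d (I + D) N)
    (Set.mem_ofPred.mpr (Nat.le_add_left _ _))
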